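/- Let N ∈ {3,4}, γ > 2(N−1)/N, and let (ρ,u) be a global classical solution on [0,∞) of the N-dimensional Euler–Poisson equations without damping (β = 0), with conserved total energy E = 0 and total mass M > 0, supported in the bounded set Ω of Lebesgue measure |Ω|. Let R(t) = max{|x| : x ∈ supp ρ(t,·)}. Then liminf_{t→∞} R(t)·|Ω|^{(γ−1)/2}/t ≥ √((Nγ−2(N−1))·K·M^{γ−1}/(γ−1)). -/

import Mathlib

open MeasureTheory Real Filter
open scoped RealInnerProductSpace Topology

noncomputable section

/-- Euclidean space `ℝ^N`. -/
abbrev Euc (N : ℕ) := EuclideanSpace ℝ (Fin N)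

/-- Divergence of a vector field on `ℝ^N`. -/
def ediv {N : ℕ} (v : Euc N → Euc N) (x : Euc N) : ℝ :=
  ∑ i, fderiv ℝ (fun y => v y i) x (EuclideanSpace.single i 1)

/-- Partial derivative of a scalar field in the `i`-th coordinate direction. -/
def epartial {N : ℕ} (i : Fin N) (f : Euc N → ℝ) (x : Euc N) : ℝ :=
  fderiv ℝ f x (EuclideanSpace.single i 1)

/-- Green's function of the Poisson equation in `ℝ^N`:
`log |x|` for `N = 2` and `-|x|^(2-N)` for `N ≥ 3`. -/
def green (N : ℕ) (x : Euc N) : ℝ :=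
  if N = 2 then Real.log ‖x‖ else -(‖x‖ ^ ((2 : ℝ) - (N : ℝ)))

/-- Gravitational potential `Φ(t,x) = g ∫ G(x-y) ρ(t,y) dy`. -/
def potential (N : ℕ) (g : ℝ) (ρ : ℝ → Euc N → ℝ) (t : ℝ) (x : Euc N) : ℝ :=
  g * ∫ y, green N (x - y) * ρ t y

/-- A classical solution on `[0,T)` (with `T : EReal`, so `T = ⊤` means a global
solution) of the `N`-dimensional Euler–Poisson equations with pressure
`P = K ρ^γ`, damping constant `β` and gravitational constant `g`:
nonnegative `C¹` density `ρ`, `C¹` velocity `u`, with `ρ(t,·)` supported in a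
fixed bounded open set `Ω`, satisfying the continuity and momentum equations
pointwise. -/
structure IsEPSolution (N : ℕ) (K γ β g : ℝ) (Ω : Set (Euc N)) (T : EReal)
    (ρ : ℝ → Euc N → ℝ) (u : ℝ → Euc N → Euc N) : Prop where
  rho_nonneg : ∀ t x, 0 ≤ ρ t x
  rho_C1 : ContDiff ℝ 1 (fun p : ℝ × Euc N => ρ p.1 p.2)
  u_C1 : ContDiff ℝ 1 (fun p : ℝ × Euc N => u p.1 p.2)
  omega_open : IsOpen Ω
  omega_bounded : Bornology.IsBounded Ω
  support_subset : ∀ t : ℝ, 0 ≤ t → (t : EReal) < T → Function.support (ρ t) ⊆ Ω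
  continuity_eq : ∀ t : ℝ, 0 ≤ t → (t : EReal) < T → ∀ x : Euc N,
    deriv (fun s => ρ s x) t + ediv (fun y => ρ t y • u t y) x = 0
  momentum_eq : ∀ t : ℝ, 0 ≤ t → (t : EReal) < T → ∀ x : Euc N, ∀ j : Fin N,
    deriv (fun s => ρ s x * u s x j) t
      + (∑ i, epartial i (fun y => ρ t y * u t y i * u t y j) x)
      + epartial j (fun y => K * ρ t y ^ γ) x
      = -(ρ t x * epartial j (potential N g ρ t) x) - β * ρ t x * u t x j

/-- Total energy (case `γ > 1`):
`E(t) = ∫_Ω (½ ρ|u|² + P/(γ-1) + ½ ρΦ) dx` with `P = K ρ^γ`. -/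
def energy (N : ℕ) (K γ g : ℝ) (Ω : Set (Euc N)) (ρ : ℝ → Euc N → ℝ)
    (u : ℝ → Euc N → Euc N) (t : ℝ) : ℝ :=
  ∫ x in Ω, ((1 / 2) * ρ t x * ‖u t x‖ ^ 2 + K * ρ t x ^ γ / (γ - 1)
    + (1 / 2) * ρ t x * potential N g ρ t x)

/-- Isothermal total energy (case `γ = 1`, `P = Kρ`):
`E(t) = ∫_Ω (½ ρ|u|² + Kρ log ρ + ½ ρΦ) dx` (note `ρ log ρ = 0` where `ρ = 0`
since `Real.log 0 = 0`). -/
def energyIso (N : ℕ) (K g : ℝ) (Ω : Set (Euc N)) (ρ : ℝ → Euc N → ℝ)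
    (u : ℝ → Euc N → Euc N) (t : ℝ) : ℝ :=
  ∫ x in Ω, ((1 / 2) * ρ t x * ‖u t x‖ ^ 2 + K * ρ t x * Real.log (ρ t x)
    + (1 / 2) * ρ t x * potential N g ρ t x)

/-- Second inertia function `H(t) = ∫_Ω ρ(t,x)|x|² dx`. -/
def inertia (N : ℕ) (Ω : Set (Euc N)) (ρ : ℝ → Euc N → ℝ) (t : ℝ) : ℝ :=
  ∫ x in Ω, ρ t x * ‖x‖ ^ 2

/-- Maximal radius of the support of `ρ(t,·)`. -/
def maxRadius (N : ℕ) (ρ : ℝ → Euc N → ℝ) (t : ℝ) : ℝ :=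
  sSup ((fun x : Euc N => ‖x‖) '' Function.support (ρ t))

lemma aux_fderiv_sum {N : ℕ} (L : Euc N →L[ℝ] ℝ) (x : Euc N) :
    L x = ∑ j, x j * L (EuclideanSpace.single j 1) := by
  have h : x = ∑ j, x j • (EuclideanSpace.single j 1 : Euc N) := by
    ext i
    simp [Finset.sum_apply, Pi.single_apply]
  conv_lhs => rw [h]
  simp [map_sum]

lemma aux_deriv_int {N : ℕ} (w : Euc N → ℝ) (hw : LocallyIntegrable w)
    (f : ℝ × Euc N → ℝ) (hf : ContDiff ℝ 1 f) (t0 δ R : ℝ) (hδ : 0 < δ)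
    (hz : ∀ t ∈ Metric.ball t0 δ, ∀ x : Euc N, R < ‖x‖ → f (t, x) = 0) :
    HasDerivAt (fun t => ∫ x, w x * f (t, x))
      (∫ x, w x * deriv (fun s => f (s, x)) t0) t0 := by
  have hd : ∀ t x, HasDerivAt (fun s => f (s, x)) (fderiv ℝ f (t, x) (1, 0)) t := by
    intro t x
    have h1 : HasFDerivAt f (fderiv ℝ f (t, x)) (t, x) :=
      ((hf.differentiable (by norm_num)) _).hasFDerivAt
    have h2 : HasDerivAt (fun s : ℝ => (s, x)) ((1 : ℝ), (0 : Euc N)) t :=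
      (hasDerivAt_id t).prodMk (hasDerivAt_const t x)
    exact h1.comp_hasDerivAt t h2
  have hcd : Continuous (fun p : ℝ × Euc N => fderiv ℝ f p (1, 0)) :=
    (hf.continuous_fderiv (by norm_num)).clm_apply continuous_const
  have hzd : ∀ t ∈ Metric.ball t0 δ, ∀ x : Euc N, R < ‖x‖ → fderiv ℝ f (t, x) (1, 0) = 0 := by
    intro t ht x hx
    have h0 : HasDerivAt (fun s => f (s, x)) 0 t := by
      apply (hasDerivAt_const t (0 : ℝ)).congr_of_eventuallyEq
      filter_upwards [Metric.isOpen_ball.mem_nhds ht] with s hs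
      exact hz s hs x hx
    exact (hd t x).unique h0
  obtain ⟨C, hC⟩ := ((isCompact_closedBall t0 (δ / 2)).prod
    (isCompact_closedBall (0 : Euc N) R)).exists_bound_of_continuousOn hcd.continuousOn
  have key := hasDerivAt_integral_of_dominated_loc_of_deriv_le (μ := (volume : Measure (Euc N)))
    (F := fun t x => w x * f (t, x)) (F' := fun t x => w x * fderiv ℝ f (t, x) (1, 0))
    (x₀ := t0) (s := Metric.ball t0 (δ / 2))
    (bound := (Metric.closedBall (0 : Euc N) R).indicator (fun x => ‖w x‖ * C))
    (Metric.ball_mem_nhds _ (by positivity)) ?_ ?_ ?_ ?_ ?_ ?_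
  · have := key.2
    have e : ∀ x, deriv (fun s => f (s, x)) t0 = fderiv ℝ f (t0, x) (1, 0) :=
      fun x => (hd t0 x).deriv
    simpa only [e] using this
  · refine Eventually.of_forall fun t => ?_
    exact hw.aestronglyMeasurable.mul
      (hf.continuous.comp (by fun_prop : Continuous fun x : Euc N => (t, x))).aestronglyMeasurable
  · have hc : HasCompactSupport (fun x : Euc N => f (t0, x)) := by
      apply HasCompactSupport.intro (isCompact_closedBall (0 : Euc N) R)
      intro x hx
      exact hz t0 (Metric.mem_ball_self hδ) x (by simpa using hx)
    exact hw.integrable_smul_right_of_hasCompactSupport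
      (hf.continuous.comp (by fun_prop : Continuous fun x : Euc N => (t0, x))) hc
  · exact hw.aestronglyMeasurable.mul
      (hcd.comp (by fun_prop : Continuous fun x : Euc N => (t0, x))).aestronglyMeasurable
  · refine Eventually.of_forall fun x t ht => ?_
    by_cases hx : x ∈ Metric.closedBall (0 : Euc N) R
    · rw [Set.indicator_of_mem hx, norm_mul]
      exact mul_le_mul_of_nonneg_left (hC (t, x) ⟨Metric.ball_subset_closedBall ht, hx⟩)
        (norm_nonneg _)
    · rw [Set.indicator_of_notMem hx,
        hzd t (Metric.ball_subset_ball (by linarith) ht) x (by simpa using hx)]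
      simp
  · rw [integrable_indicator_iff measurableSet_closedBall]
    exact (((hw.integrableOn_isCompact (isCompact_closedBall _ _)).norm).mul_const C)
  · refine Eventually.of_forall fun x t _ => ?_
    exact (hd t x).const_mul _

lemma aux_green_li {N : ℕ} (hN : 3 ≤ N) : LocallyIntegrable (green N) := by
  have hN' : (3 : ℝ) ≤ N := by exact_mod_cast hN
  refine locallyIntegrable_of_norm_le_rpow (C := 1) (α := (N : ℝ) - 2) ?_ ?_ ?_ ?_
  · simp; omega
  · simp
  · refine Eventually.of_forall fun x => ?_
    have : N ≠ 2 := by omega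
    simp only [green, this, if_false, norm_neg, one_mul, neg_sub]
    rw [Real.norm_of_nonneg (Real.rpow_nonneg (norm_nonneg _) _)]
  · have : N ≠ 2 := by omega
    have h : green N = fun x => -(‖x‖ ^ ((2 : ℝ) - (N : ℝ))) := by
      funext x; simp [green, this]
    rw [h]
    exact ((measurable_norm.pow_const _).neg).aestronglyMeasurable

lemma aux_green_homog {N : ℕ} (hN : 3 ≤ N) (f : Euc N → ℝ) (hf : ContDiff ℝ 1 f)
    (hc : HasCompactSupport f) :
    ∫ z, green N z * fderiv ℝ f z z = -2 * ∫ z, green N z * f z := by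
  obtain ⟨R, hR0, hR⟩ := hc.isCompact.isBounded.exists_pos_norm_lt
  have hfz : ∀ x, R ≤ ‖x‖ → f x = 0 := by
    intro x hx
    by_contra h
    exact absurd (hR x (subset_tsupport f h)) (by linarith)
  have h1 := aux_deriv_int (green N) (aux_green_li hN) (fun p => f (p.1 • p.2))
    (hf.comp (contDiff_fst.smul contDiff_snd)) 1 (1 / 2) (2 * R) (by norm_num) (by
      intro t ht x hx
      rw [Metric.mem_ball, Real.dist_eq, abs_lt] at ht
      apply hfz
      rw [norm_smul, Real.norm_of_nonneg (by linarith)]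
      nlinarith [norm_nonneg x])
  have e1 : ∀ x, deriv (fun s : ℝ => f (s • x)) 1 = fderiv ℝ f x x := by
    intro x
    have h2 : HasDerivAt (fun s : ℝ => s • x) ((1 : ℝ) • x) 1 :=
      (hasDerivAt_id (1 : ℝ)).smul_const x
    have h3 : HasFDerivAt f (fderiv ℝ f x) ((1 : ℝ) • x) := by
      rw [one_smul]; exact ((hf.differentiable (by norm_num)) _).hasFDerivAt
    have := (h3.comp_hasDerivAt (1 : ℝ) h2).deriv
    rw [one_smul] at this
    exact this
  simp only [e1] at h1
  have h4 : HasDerivAt (fun t : ℝ => t ^ (-2 : ℝ) * ∫ z, green N z * f z)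
      (-2 * ∫ z, green N z * f z) 1 := by
    have := (Real.hasDerivAt_rpow_const (x := 1) (p := -2) (Or.inl one_ne_zero)).mul_const
      (∫ z, green N z * f z)
    simpa using this
  refine h1.unique (h4.congr_of_eventuallyEq ?_)
  filter_upwards [lt_mem_nhds (show (0 : ℝ) < 1 by norm_num)] with t ht
  have h5 := Measure.integral_comp_smul (volume : Measure (Euc N)) (fun z => green N z * f z) t
  have h6 : ∀ z : Euc N, green N z * f (t • z)
      = t ^ ((N : ℝ) - 2) * (green N (t • z) * f (t • z)) := by
    intro z
    have : N ≠ 2 := by omega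
    simp only [green, this, if_false, norm_smul, Real.norm_of_nonneg ht.le]
    rw [Real.mul_rpow ht.le (norm_nonneg _)]
    have : t ^ ((N : ℝ) - 2) * t ^ ((2 : ℝ) - N) = 1 := by
      rw [← Real.rpow_add ht]; simp
    linear_combination (-(‖z‖ ^ ((2 : ℝ) - N)) * f (t • z)) * (-this)
  simp only [h6]
  rw [integral_const_mul, h5, smul_eq_mul, ← mul_assoc]
  congr 1
  rw [abs_of_pos (by positivity), finrank_euclideanSpace_fin, ← Real.rpow_natCast,
    ← Real.rpow_neg ht.le, ← Real.rpow_add ht]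
  congr 1; ring

lemma aux_ibp {N : ℕ} (φ f : Euc N → ℝ) (hφ : ContDiff ℝ 1 φ) (hf : ContDiff ℝ 1 f)
    (hc : HasCompactSupport f) (v : Euc N) :
    ∫ x, φ x * fderiv ℝ f x v = - ∫ x, fderiv ℝ φ x v * f x := by
  have hf' : Continuous fun x => fderiv ℝ f x v :=
    (hf.continuous_fderiv (by norm_num)).clm_apply continuous_const
  have hφ' : Continuous fun x => fderiv ℝ φ x v :=
    (hφ.continuous_fderiv (by norm_num)).clm_apply continuous_const
  apply integral_mul_fderiv_eq_neg_fderiv_mul_of_integrable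
  · exact (hφ'.mul hf.continuous).integrable_of_hasCompactSupport hc.mul_left
  · exact (hφ.continuous.mul hf').integrable_of_hasCompactSupport
      (hc.fderiv_apply (𝕜 := ℝ) v).mul_left
  · exact (hφ.continuous.mul hf.continuous).integrable_of_hasCompactSupport hc.mul_left
  · intro x _; exact hφ.differentiable (by norm_num) x
  · intro x _; exact hf.differentiable (by norm_num) x

lemma aux_coord {N : ℕ} (j : Fin N) (x v : Euc N) :
    fderiv ℝ (fun x : Euc N => x j) x v = v j := by
  have := (EuclideanSpace.proj j : Euc N →L[ℝ] ℝ).hasFDerivAt (x := x)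
  exact congrArg (fun L => L v) this.fderiv

/-- The convolution with the Green function. -/
def auxPhi (N : ℕ) (f : Euc N → ℝ) : Euc N → ℝ :=
  convolution (green N) f (ContinuousLinearMap.mul ℝ ℝ) volume

lemma auxPhi_apply {N : ℕ} (f : Euc N → ℝ) (x : Euc N) :
    auxPhi N f x = ∫ z, green N z * f (x - z) := rfl

lemma auxPhi_apply' {N : ℕ} (f : Euc N → ℝ) (x : Euc N) :
    auxPhi N f x = ∫ y, green N (x - y) * f y := by
  rw [auxPhi_apply, ← integral_sub_left_eq_self _ _ x]
  simp

lemma aux_potential {N : ℕ} (g : ℝ) (ρ : ℝ → Euc N → ℝ) (t : ℝ) :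
    potential N g ρ t = fun x => g * auxPhi N (ρ t) x := by
  funext x
  rw [potential, auxPhi_apply']

lemma auxPhi_C1 {N : ℕ} (hN : 3 ≤ N) (f : Euc N → ℝ) (hf : ContDiff ℝ 1 f)
    (hc : HasCompactSupport f) : ContDiff ℝ 1 (auxPhi N f) :=
  hc.contDiff_convolution_right (n := 1) _ (aux_green_li hN) hf

lemma auxPhi_cont {N : ℕ} (hN : 3 ≤ N) (f : Euc N → ℝ) (hf : Continuous f)
    (hc : HasCompactSupport f) : Continuous (auxPhi N f) :=
  hc.continuous_convolution_right _ (aux_green_li hN) hf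

lemma auxPhi_fderiv {N : ℕ} (hN : 3 ≤ N) (f : Euc N → ℝ) (hf : ContDiff ℝ 1 f)
    (hc : HasCompactSupport f) (x : Euc N) :
    fderiv ℝ (auxPhi N f) x x = auxPhi N (fun y => fderiv ℝ f y y) x + 2 * auxPhi N f x := by
  have h1 := (hc.hasFDerivAt_convolution_right (ContinuousLinearMap.mul ℝ ℝ)
    (aux_green_li hN) hf x).fderiv
  have hfc : Continuous (fderiv ℝ f) := hf.continuous_fderiv (by norm_num)
  have h2 : fderiv ℝ (auxPhi N f) x x = ∫ z, green N z * fderiv ℝ f (x - z) x := by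
    rw [auxPhi, h1, convolution_precompR_apply _ (aux_green_li hN) (hc.fderiv (𝕜 := ℝ)) hfc]
    rfl
  have hsub : ContDiff ℝ 1 (fun z => f (x - z)) := hf.comp (contDiff_const.sub contDiff_id)
  have hsubc : HasCompactSupport (fun z => f (x - z)) :=
    hc.comp_homeomorph (Homeomorph.subLeft x)
  have h3 := aux_green_homog hN _ hsub hsubc
  have h4 : ∀ z v, fderiv ℝ (fun z => f (x - z)) z v = - fderiv ℝ f (x - z) v := by
    intro z v
    have ha : HasFDerivAt (fun z => x - z) (-ContinuousLinearMap.id ℝ (Euc N)) z :=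
      (hasFDerivAt_id z).const_sub x
    have hb : HasFDerivAt f (fderiv ℝ f (x - z)) (x - z) :=
      ((hf.differentiable (by norm_num)) _).hasFDerivAt
    have := (hb.comp z ha).fderiv
    change fderiv ℝ (f ∘ fun z => x - z) z v = _
    rw [this]; simp
  simp only [h4] at h3
  have hfcs : HasCompactSupport (fun z => fderiv ℝ f (x - z)) :=
    (hc.fderiv (𝕜 := ℝ)).comp_homeomorph (Homeomorph.subLeft x)
  have hfz : ∀ z, fderiv ℝ f (x - z) = 0 → ∀ v, fderiv ℝ f (x - z) v = 0 := by
    intro z hz v; rw [hz]; rfl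
  have i1 : Integrable (fun z => green N z * fderiv ℝ f (x - z) (x - z)) :=
    (aux_green_li hN).integrable_smul_right_of_hasCompactSupport
      ((hfc.comp (by fun_prop)).clm_apply (by fun_prop))
      (hfcs.mono' (fun z hz => subset_tsupport _ (fun h => hz (hfz z h _))))
  have i2 : Integrable (fun z => green N z * -fderiv ℝ f (x - z) z) :=
    (aux_green_li hN).integrable_smul_right_of_hasCompactSupport
      ((hfc.comp (by fun_prop)).clm_apply (by fun_prop)).neg
      (hfcs.mono' (fun z hz => subset_tsupport _ (fun h => hz (by
        show -fderiv ℝ f (x - z) z = 0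
        rw [hfz z h, neg_zero]))))
  rw [h2, auxPhi_apply, auxPhi_apply]
  have h5 : ∫ z, green N z * fderiv ℝ f (x - z) x
      = (∫ z, green N z * fderiv ℝ f (x - z) (x - z))
        - ∫ z, green N z * -fderiv ℝ f (x - z) z := by
    rw [← integral_sub i1 i2]
    congr 1; funext z
    rw [map_sub]; ring
  rw [h5, h3]; ring

lemma auxPhi_symm {N : ℕ} (hN : 3 ≤ N) (f h : Euc N → ℝ) (hf : Continuous f)
    (hfc : HasCompactSupport f) (hh : Continuous h) (hhc : HasCompactSupport h) :
    ∫ x, f x * auxPhi N h x = ∫ x, h x * auxPhi N f x := by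
  have heven : ∀ x y : Euc N, green N (x - y) = green N (y - x) := by
    intro x y; simp only [green, norm_sub_rev]
  simp only [auxPhi_apply', ← integral_const_mul]
  rw [integral_integral_swap]
  · congr 1; funext y; congr 1; funext x
    rw [heven]; ring
  · obtain ⟨R, hR0, hR⟩ := (hfc.isCompact.isBounded.union hhc.isCompact.isBounded).exists_pos_norm_lt
    obtain ⟨C, hC⟩ := hfc.exists_bound_of_continuous hf
    have hC0 : 0 ≤ C := (norm_nonneg _).trans (hC 0)
    have hGi : Integrable ((Metric.closedBall (0 : Euc N) (2 * R)).indicator (green N)) := by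
      rw [integrable_indicator_iff measurableSet_closedBall]
      exact (aux_green_li hN).integrableOn_isCompact (isCompact_closedBall _ _)
    have hhi : Integrable h := hh.integrable_of_hasCompactSupport hhc
    have hprod := (Integrable.convolution_integrand (ContinuousLinearMap.mul ℝ ℝ)
      (μ := (volume : Measure (Euc N))) hhi hGi)
    have hm := hprod.bdd_mul (f := fun p : Euc N × Euc N => f p.1) (c := C)
      (hf.comp continuous_fst).aestronglyMeasurable (Eventually.of_forall fun p => hC p.1)
    refine hm.congr (Eventually.of_forall ?_)
    rintro ⟨x, y⟩
    simp only [Function.uncurry_apply_pair, ContinuousLinearMap.mul_apply']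
    by_cases hx : f x = 0
    · simp [hx]
    by_cases hy : h y = 0
    · simp [hy]
    have hx' := hR x (Or.inl (subset_tsupport f hx))
    have hy' := hR y (Or.inr (subset_tsupport h hy))
    rw [Set.indicator_of_mem]
    · ring
    · rw [mem_closedBall_zero_iff]
      linarith [norm_sub_le x y]

lemma aux_virial {N : ℕ} (hN : 3 ≤ N) (f : Euc N → ℝ) (hf : ContDiff ℝ 1 f)
    (hc : HasCompactSupport f) :
    ∫ x, f x * fderiv ℝ (auxPhi N f) x x = (2 - (N : ℝ)) / 2 * ∫ x, f x * auxPhi N f x := by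
  have hfc : Continuous (fderiv ℝ f) := hf.continuous_fderiv (by norm_num)
  have hA : Continuous (fun y => fderiv ℝ f y y) := hfc.clm_apply continuous_id
  have hAc : HasCompactSupport (fun y => fderiv ℝ f y y) :=
    (hc.fderiv (𝕜 := ℝ)).mono' (fun z hz => subset_tsupport _ (fun h => hz (by
      show fderiv ℝ f z z = 0
      rw [h]; rfl)))
  have hΦ := auxPhi_C1 hN f hf hc
  have hΦc : Continuous (fderiv ℝ (auxPhi N f)) := hΦ.continuous_fderiv (by norm_num)
  have iff' : Integrable (fun x => f x * auxPhi N f x) :=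
    (hf.continuous.mul hΦ.continuous).integrable_of_hasCompactSupport hc.mul_right
  -- first identity
  have e1 : ∫ x, f x * fderiv ℝ (auxPhi N f) x x
      = (∫ x, f x * auxPhi N (fun y => fderiv ℝ f y y) x) + 2 * ∫ x, f x * auxPhi N f x := by
    rw [← integral_const_mul, ← integral_add]
    · congr 1; funext x
      rw [auxPhi_fderiv hN f hf hc]; ring
    · exact (hf.continuous.mul (auxPhi_cont hN _ hA hAc)).integrable_of_hasCompactSupport
        hc.mul_right
    · exact iff'.const_mul 2
  rw [auxPhi_symm hN _ _ hf.continuous hc hA hAc] at e1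
  -- second identity
  have hcoord : ∀ j, ContDiff ℝ 1 (fun x : Euc N => x j) := fun j => by fun_prop
  have hcoordd := @aux_coord N
  have e2 : ∀ j : Fin N, ∫ x, f x * (x j * fderiv ℝ (auxPhi N f) x (EuclideanSpace.single j 1))
      = - ∫ x, (f x + x j * fderiv ℝ f x (EuclideanSpace.single j 1)) * auxPhi N f x := by
    intro j
    have hfx : ContDiff ℝ 1 (fun x : Euc N => f x * x j) := hf.mul (hcoord j)
    have := aux_ibp (auxPhi N f) (fun x => f x * x j) hΦ hfx hc.mul_right
      (EuclideanSpace.single j 1)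
    rw [← neg_eq_iff_eq_neg] at this
    calc _ = ∫ x, fderiv ℝ (auxPhi N f) x (EuclideanSpace.single j 1) * (f x * x j) := by
            congr 1; funext x; ring
      _ = _ := by
            rw [← this]; congr 2; funext x
            have hd : fderiv ℝ (fun x : Euc N => f x * x j) x (EuclideanSpace.single j 1)
                = f x + x j * fderiv ℝ f x (EuclideanSpace.single j 1) := by
              rw [fderiv_fun_mul (hf.differentiable (by norm_num) x)
                ((hcoord j).differentiable (by norm_num) x)]
              simp [hcoordd]
            rw [hd]; ring
  have e3 : ∫ x, f x * fderiv ℝ (auxPhi N f) x x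
      = -((N : ℝ) * (∫ x, f x * auxPhi N f x) + ∫ x, fderiv ℝ f x x * auxPhi N f x) := by
    have s1 : ∀ x, f x * fderiv ℝ (auxPhi N f) x x
        = ∑ j, f x * (x j * fderiv ℝ (auxPhi N f) x (EuclideanSpace.single j 1)) := by
      intro x
      rw [← Finset.mul_sum, ← aux_fderiv_sum]
    simp only [s1]
    rw [integral_finsetSum, Finset.sum_congr rfl (fun j _ => e2 j), Finset.sum_neg_distrib,
      ← integral_finsetSum, ← integral_const_mul, ← integral_add]
    · congr 2; funext x
      rw [← Finset.sum_mul, Finset.sum_add_distrib, ← aux_fderiv_sum]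
      simp; ring
    · exact iff'.const_mul _
    · exact (hA.mul hΦ.continuous).integrable_of_hasCompactSupport hAc.mul_right
    · intro j _
      refine Continuous.integrable_of_hasCompactSupport ?_ ?_
      · exact (hf.continuous.add ((hcoord j).continuous.mul
          (hfc.clm_apply continuous_const))).mul hΦ.continuous
      · exact (hc.add (hc.fderiv_apply (𝕜 := ℝ) _).mul_left).mul_right
    · intro j _
      refine Continuous.integrable_of_hasCompactSupport ?_ hc.mul_right
      exact hf.continuous.mul ((hcoord j).continuous.mul (hΦc.clm_apply continuous_const))
  have comm : ∫ x, fderiv ℝ f x x * auxPhi N f x = ∫ x, (fun y => fderiv ℝ f y y) x * auxPhi N f x := rfl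
  linarith

/-- First moment of the momentum. -/
def auxF (N : ℕ) (ρ : ℝ → Euc N → ℝ) (u : ℝ → Euc N → Euc N) (t : ℝ) : ℝ :=
  ∑ j : Fin N, ∫ x, x j * (ρ t x * u t x j)

lemma aux_coord_C1 {N : ℕ} (j : Fin N) : ContDiff ℝ 1 (fun x : Euc N => x j) := by fun_prop

lemma auxu_C1 {N : ℕ} {u : ℝ → Euc N → Euc N}
    (hu : ContDiff ℝ 1 (fun p : ℝ × Euc N => u p.1 p.2)) (j : Fin N) :
    ContDiff ℝ 1 (fun p : ℝ × Euc N => u p.1 p.2 j) :=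
  (aux_coord_C1 j).comp hu

lemma aux_slice {N : ℕ} {f : ℝ × Euc N → ℝ} (hf : ContDiff ℝ 1 f) (t : ℝ) :
    ContDiff ℝ 1 (fun x => f (t, x)) :=
  hf.comp (contDiff_const.prodMk contDiff_id)

lemma aux_H {N : ℕ} {K γ g : ℝ} {Ω : Set (Euc N)} {ρ : ℝ → Euc N → ℝ} {u : ℝ → Euc N → Euc N}
    (hsol : IsEPSolution N K γ 0 g Ω ⊤ ρ u) (R : ℝ)
    (hR : ∀ t, 0 ≤ t → ∀ x, R < ‖x‖ → ρ t x = 0) (t : ℝ) (ht : 0 < t) :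
    HasDerivAt (fun t => ∫ x, ‖x‖ ^ 2 * ρ t x) (2 * auxF N ρ u t) t := by
  have hw : ContDiff ℝ 1 (fun x : Euc N => ‖x‖ ^ 2) := contDiff_norm_sq ℝ
  have h1 := aux_deriv_int (fun x : Euc N => ‖x‖ ^ 2) hw.continuous.locallyIntegrable
    _ hsol.rho_C1 t t R ht (by
      intro s hs x hx
      rw [Metric.mem_ball, Real.dist_eq, abs_lt] at hs
      exact hR s (by linarith) x hx)
  convert h1 using 1
  have hcs : HasCompactSupport (ρ t) :=
    HasCompactSupport.intro (isCompact_closedBall (0 : Euc N) R) (fun x hx =>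
      hR t ht.le x (by simpa using hx))
  have hfi : ∀ i, ContDiff ℝ 1 (fun x => ρ t x * u t x i) := fun i =>
    (aux_slice hsol.rho_C1 t).mul (aux_slice (auxu_C1 hsol.u_C1 i) t)
  have hfic : ∀ i, HasCompactSupport (fun x => ρ t x * u t x i) := fun i => hcs.mul_right
  have e : ∀ x, ‖x‖ ^ 2 * deriv (fun s => ρ s x) t
      = - ∑ i, ‖x‖ ^ 2 * fderiv ℝ (fun x => ρ t x * u t x i) x (EuclideanSpace.single i 1) := by
    intro x
    have h := hsol.continuity_eq t ht.le (EReal.coe_lt_top t) x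
    have h' : ediv (fun y => ρ t y • u t y) x
        = ∑ i, fderiv ℝ (fun x => ρ t x * u t x i) x (EuclideanSpace.single i 1) := rfl
    rw [← Finset.mul_sum, ← h']
    linear_combination (‖x‖ ^ 2) * h
  simp only [e]
  rw [integral_neg, integral_finsetSum, auxF, Finset.mul_sum, ← Finset.sum_neg_distrib]
  · apply Finset.sum_congr rfl
    intro i _
    rw [aux_ibp _ _ hw (hfi i) (hfic i), neg_neg, ← integral_const_mul]
    congr 1; funext x
    have hn : fderiv ℝ (fun x : Euc N => ‖x‖ ^ 2) x (EuclideanSpace.single i 1) = 2 * x i := by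
      rw [fderiv_norm_sq_apply]
      simp [EuclideanSpace.inner_single_right]
    rw [hn]; ring
  · intro i _
    refine Continuous.integrable_of_hasCompactSupport ?_
      ((hfic i).fderiv_apply (𝕜 := ℝ) _).mul_left
    exact hw.continuous.mul (((hfi i).continuous_fderiv (by norm_num)).clm_apply continuous_const)

lemma aux_F {N : ℕ} (hN : 3 ≤ N) {K γ g : ℝ} (hγ : 1 ≤ γ) {Ω : Set (Euc N)} {ρ : ℝ → Euc N → ℝ}
    {u : ℝ → Euc N → Euc N}
    (hsol : IsEPSolution N K γ 0 g Ω ⊤ ρ u) (R : ℝ)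
    (hR : ∀ t, 0 ≤ t → ∀ x, R < ‖x‖ → ρ t x = 0) (t : ℝ) (ht : 0 < t) :
    HasDerivAt (auxF N ρ u) ((∫ x, ρ t x * ‖u t x‖ ^ 2) + N * (∫ x, K * ρ t x ^ γ)
      + g * (((N : ℝ) - 2) / 2) * ∫ x, ρ t x * auxPhi N (ρ t) x) t := by
  have hρ1 : ContDiff ℝ 1 (ρ t) := aux_slice hsol.rho_C1 t
  have hu1 : ∀ j, ContDiff ℝ 1 (fun x => u t x j) := fun j => aux_slice (auxu_C1 hsol.u_C1 j) t
  have hcs : HasCompactSupport (ρ t) :=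
    HasCompactSupport.intro (isCompact_closedBall (0 : Euc N) R) (fun x hx =>
      hR t ht.le x (by simpa using hx))
  have hP1 : ContDiff ℝ 1 (fun x => K * ρ t x ^ γ) :=
    contDiff_const.mul (ContDiff.rpow_const_of_le (m := 1) (by exact_mod_cast hρ1) (by simpa using hγ))
  have hPc : HasCompactSupport (fun x => K * ρ t x ^ γ) :=
    HasCompactSupport.intro (isCompact_closedBall (0 : Euc N) R) (fun x hx => by
      rw [hR t ht.le x (by simpa using hx), Real.zero_rpow (by linarith), mul_zero])
  have hΦ := auxPhi_C1 hN (ρ t) hρ1 hcs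
  have hΦc : Continuous (fderiv ℝ (auxPhi N (ρ t))) := hΦ.continuous_fderiv (by norm_num)
  have hq1 : ∀ i j, ContDiff ℝ 1 (fun x => ρ t x * u t x i * u t x j) := fun i j =>
    (hρ1.mul (hu1 i)).mul (hu1 j)
  have hqc : ∀ i j, HasCompactSupport (fun x => ρ t x * u t x i * u t x j) := fun i j =>
    hcs.mul_right.mul_right
  have hxd : ∀ i j : Fin N, ∀ f : Euc N → ℝ, ContDiff ℝ 1 f → HasCompactSupport f →
      (∫ x : Euc N, x j * fderiv ℝ f x (EuclideanSpace.single i 1))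
        = if j = i then - ∫ x, f x else 0 := by
    intro i j f hf hfc
    rw [aux_ibp _ _ (aux_coord_C1 j) hf hfc]
    simp only [aux_coord]
    by_cases h : j = i
    · simp [h]
    · simp [h]
  have hxi : ∀ i j : Fin N, ∀ f : Euc N → ℝ, ContDiff ℝ 1 f → HasCompactSupport f →
      Integrable (fun x : Euc N => x j * fderiv ℝ f x (EuclideanSpace.single i 1)) := by
    intro i j f hf hfc
    refine Continuous.integrable_of_hasCompactSupport ?_ (hfc.fderiv_apply (𝕜 := ℝ) _).mul_left
    exact (aux_coord_C1 j).continuous.mul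
      ((hf.continuous_fderiv (by norm_num)).clm_apply continuous_const)
  have hΦi : ∀ j : Fin N, Integrable (fun x : Euc N => ρ t x *
      (x j * fderiv ℝ (auxPhi N (ρ t)) x (EuclideanSpace.single j 1))) := by
    intro j
    refine Continuous.integrable_of_hasCompactSupport ?_ hcs.mul_right
    exact hρ1.continuous.mul ((aux_coord_C1 j).continuous.mul (hΦc.clm_apply continuous_const))
  have hj : ∀ j : Fin N, HasDerivAt (fun t => ∫ x, x j * (ρ t x * u t x j))
      ((∫ x, ρ t x * u t x j * u t x j) + (∫ x, K * ρ t x ^ γ)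
        - g * ∫ x, ρ t x * (x j * fderiv ℝ (auxPhi N (ρ t)) x (EuclideanSpace.single j 1))) t := by
    intro j
    have h1 := aux_deriv_int (fun x : Euc N => x j) (aux_coord_C1 j).continuous.locallyIntegrable
      (fun p => ρ p.1 p.2 * u p.1 p.2 j) (hsol.rho_C1.mul (auxu_C1 hsol.u_C1 j)) t t R ht (by
        intro s hs x hx
        rw [Metric.mem_ball, Real.dist_eq, abs_lt] at hs
        simp only [hR s (by linarith) x hx, zero_mul])
    convert h1 using 1
    have hpot : ∀ x, epartial j (potential N g ρ t) x
        = g * fderiv ℝ (auxPhi N (ρ t)) x (EuclideanSpace.single j 1) := by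
      intro x
      rw [epartial, aux_potential, fderiv_const_mul (hΦ.differentiable (by norm_num) x)]
      rfl
    have e : ∀ x : Euc N, x j * deriv (fun s => ρ s x * u s x j) t
        = - ((∑ i, x j * fderiv ℝ (fun y => ρ t y * u t y i * u t y j) x (EuclideanSpace.single i 1))
          + x j * fderiv ℝ (fun y => K * ρ t y ^ γ) x (EuclideanSpace.single j 1)
          + g * (ρ t x * (x j * fderiv ℝ (auxPhi N (ρ t)) x (EuclideanSpace.single j 1)))) := by
      intro x
      have h := hsol.momentum_eq t ht.le (EReal.coe_lt_top t) x j
      rw [hpot] at h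
      simp only [epartial] at h
      rw [← Finset.mul_sum]
      linear_combination (x j) * h
    simp only [e]
    rw [integral_neg, integral_add _ ((hΦi j).const_mul g), integral_add _ (hxi j j _ hP1 hPc),
      integral_finsetSum, hxd j j _ hP1 hPc, integral_const_mul g]
    · rw [Finset.sum_congr rfl (fun i _ => hxd i j _ (hq1 i j) (hqc i j))]
      simp; ring
    · intro i _
      exact hxi i j _ (hq1 i j) (hqc i j)
    · exact integrable_finsetSum _ fun i _ => hxi i j _ (hq1 i j) (hqc i j)
    · exact (integrable_finsetSum _ fun i _ => hxi i j _ (hq1 i j) (hqc i j)).add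
        (hxi j j _ hP1 hPc)
  have hs := HasDerivAt.fun_sum (u := Finset.univ) (fun j _ => hj j)
  refine hs.congr_deriv ?_
  have hv := aux_virial hN (ρ t) hρ1 hcs
  have s1 : ∀ x, ρ t x * fderiv ℝ (auxPhi N (ρ t)) x x
        = ∑ j, ρ t x * (x j * fderiv ℝ (auxPhi N (ρ t)) x (EuclideanSpace.single j 1)) := by
    intro x
    rw [← Finset.mul_sum, ← aux_fderiv_sum]
  simp only [s1] at hv
  rw [integral_finsetSum _ (fun j _ => hΦi j)] at hv
  rw [Finset.sum_sub_distrib, Finset.sum_add_distrib, ← Finset.mul_sum, hv,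
    ← integral_finsetSum _ (fun j _ =>
      ((hq1 j j).continuous.integrable_of_hasCompactSupport (hqc j j)))]
  have s2 : ∀ x, ∑ j, ρ t x * u t x j * u t x j = ρ t x * ‖u t x‖ ^ 2 := by
    intro x
    rw [EuclideanSpace.norm_sq_eq, Finset.mul_sum]
    apply Finset.sum_congr rfl
    intro j _
    rw [Real.norm_eq_abs, sq_abs]; ring
  simp only [s2]
  simp
  ring

lemma aux_blowup (H F : ℝ → ℝ) (D : ℝ → ℝ) (c B : ℝ) (hc : 0 < c)
    (hH : ∀ t, 0 < t → HasDerivAt H (2 * F t) t) (hF : ∀ t, 0 < t → HasDerivAt F (D t) t)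
    (hD : ∀ t, 0 < t → c ≤ D t) (hB : ∀ t, 0 < t → H t ≤ B) : False := by
  have m1 : MonotoneOn (fun t => F t - c * t) (Set.Ici 1) := by
    have hd : ∀ t, 0 < t → HasDerivAt (fun t => F t - c * t) (D t - c * 1) t := fun t ht =>
      (hF t ht).sub ((hasDerivAt_id t).const_mul c)
    apply monotoneOn_of_deriv_nonneg (convex_Ici 1)
    · intro t ht
      exact (hd t (lt_of_lt_of_le one_pos ht)).continuousAt.continuousWithinAt
    · intro t ht
      rw [interior_Ici] at ht
      exact (hd t (lt_trans one_pos ht)).differentiableAt.differentiableWithinAt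
    · intro t ht
      rw [interior_Ici] at ht
      rw [(hd t (lt_trans one_pos ht)).deriv]
      linarith [hD t (lt_trans one_pos ht)]
  set a := F 1 - c with ha
  have hFlow : ∀ t, 1 ≤ t → a + c * t ≤ F t := by
    intro t ht
    have := m1 (Set.mem_Ici.2 le_rfl) (Set.mem_Ici.2 ht) ht
    simp only at this
    linarith
  have m2 : MonotoneOn (fun t => H t - (2 * a * t + c * t ^ 2)) (Set.Ici 1) := by
    have hd : ∀ t, 0 < t → HasDerivAt (fun t => H t - (2 * a * t + c * t ^ 2))
        (2 * F t - (2 * a * 1 + c * (2 * t))) t := fun t ht => by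
      have h2 : HasDerivAt (fun t : ℝ => t ^ 2) (2 * t) t := by simpa using hasDerivAt_pow 2 t
      exact (hH t ht).sub (((hasDerivAt_id t).const_mul (2 * a)).add (h2.const_mul c))
    apply monotoneOn_of_deriv_nonneg (convex_Ici 1)
    · intro t ht
      exact (hd t (lt_of_lt_of_le one_pos ht)).continuousAt.continuousWithinAt
    · intro t ht
      rw [interior_Ici] at ht
      exact (hd t (lt_trans one_pos ht)).differentiableAt.differentiableWithinAt
    · intro t ht
      rw [interior_Ici] at ht
      rw [(hd t (lt_trans one_pos ht)).deriv]
      linarith [hFlow t (le_of_lt ht)]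
  set b := H 1 - (2 * a + c) with hb
  have hHlow : ∀ t, 1 ≤ t → b + 2 * a * t + c * t ^ 2 ≤ B := by
    intro t ht
    have := m2 (Set.mem_Ici.2 le_rfl) (Set.mem_Ici.2 ht) ht
    simp only at this
    linarith [hB t (by linarith)]
  set T := 1 + (2 * |a| + |b| + |B| + 1) / c with hT
  have hT1 : 1 ≤ T := by rw [hT]; linarith [show 0 ≤ (2 * |a| + |b| + |B| + 1) / c by positivity]
  have hcT : c * T = c + (2 * |a| + |b| + |B| + 1) := by rw [hT]; field_simp
  have := hHlow T hT1
  have h3 : c * T ^ 2 = (c + (2 * |a| + |b| + |B| + 1)) * T := by rw [← hcT]; ring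
  nlinarith [neg_abs_le a, neg_abs_le b, le_abs_self B, abs_nonneg b, abs_nonneg B, abs_nonneg a,
    mul_nonneg (abs_nonneg b) (sub_nonneg.2 hT1), mul_nonneg (abs_nonneg B) (sub_nonneg.2 hT1),
    mul_nonneg (show 0 ≤ a + |a| by linarith [neg_abs_le a]) (show 0 ≤ T by linarith)]

/-- For `N ∈ {3,4}`, `γ > 2(N-1)/N`, a global classical solution
of the Euler–Poisson equations without damping with conserved total energy
`E = 0` and total mass `M > 0` satisfies
`liminf_{t→∞} R(t)|Ω|^((γ-1)/2)/t ≥ √((Nγ-2(N-1))K M^(γ-1)/(γ-1))`. -/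
theorem expansion_rate_zero_energy (N : ℕ) (hN : N = 3 ∨ N = 4) (K γ g : ℝ)
    (hK : 0 < K) (hg : 0 < g) (hγ : 2 * ((N : ℝ) - 1) / N < γ)
    (Ω : Set (Euc N)) (ρ : ℝ → Euc N → ℝ) (u : ℝ → Euc N → Euc N)
    (hsol : IsEPSolution N K γ 0 g Ω ⊤ ρ u)
    (M : ℝ) (hE : ∀ t : ℝ, 0 ≤ t → energy N K γ g Ω ρ u t = 0)
    (hM : ∀ t : ℝ, 0 ≤ t → (∫ x in Ω, ρ t x) = M) (hMpos : 0 < M) :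
    Real.sqrt (((N : ℝ) * γ - 2 * ((N : ℝ) - 1)) * K * M ^ (γ - 1) / (γ - 1))
      ≤ Filter.liminf
          (fun t : ℝ =>
            maxRadius N ρ t * (volume Ω).toReal ^ ((γ - 1) / 2) / t)
          Filter.atTop := by
  exfalso
  have hN3 : 3 ≤ N := by omega
  have hN3r : (3 : ℝ) ≤ N := by exact_mod_cast hN3
  have hN4r : (N : ℝ) ≤ 4 := by exact_mod_cast (show N ≤ 4 by omega)
  have hγN : 2 * ((N : ℝ) - 1) < γ * N := by rwa [div_lt_iff₀ (by linarith)] at hγ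
  have hγ1 : 1 < γ := by nlinarith
  obtain ⟨R, hR0, hRΩ⟩ := hsol.omega_bounded.exists_pos_norm_lt
  have hΩz : ∀ t, 0 ≤ t → ∀ x, x ∉ Ω → ρ t x = 0 := by
    intro t ht x hx
    by_contra h
    exact hx (hsol.support_subset t ht (EReal.coe_lt_top t) h)
  have hR : ∀ t, 0 ≤ t → ∀ x, R < ‖x‖ → ρ t x = 0 := by
    intro t ht x hx
    exact hΩz t ht x fun h => absurd (hRΩ x h) (by linarith)
  have hcs : ∀ t, 0 ≤ t → HasCompactSupport (ρ t) := fun t ht =>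
    HasCompactSupport.intro (isCompact_closedBall (0 : Euc N) R) (fun x hx =>
      hR t ht x (by simpa using hx))
  have hρ1 : ∀ t, ContDiff ℝ 1 (ρ t) := fun t => aux_slice hsol.rho_C1 t
  have huc : ∀ t, Continuous (u t) := fun t =>
    hsol.u_C1.continuous.comp (by fun_prop : Continuous fun x : Euc N => (t, x))
  have hρi : ∀ t, 0 ≤ t → Integrable (ρ t) := fun t ht =>
    (hρ1 t).continuous.integrable_of_hasCompactSupport (hcs t ht)
  have hM' : ∀ t, 0 ≤ t → ∫ x, ρ t x = M := by
    intro t ht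
    rw [← hM t ht, setIntegral_eq_integral_of_forall_compl_eq_zero (fun x hx => hΩz t ht x hx)]
  have hPi : ∀ t, 0 ≤ t → Integrable (fun x => K * ρ t x ^ γ) := by
    intro t ht
    refine Continuous.integrable_of_hasCompactSupport ?_ ?_
    · exact continuous_const.mul ((hρ1 t).continuous.rpow_const fun x => Or.inr (by linarith))
    · refine HasCompactSupport.intro (isCompact_closedBall (0 : Euc N) R) (fun x hx => ?_)
      rw [hR t ht x (by simpa using hx), Real.zero_rpow (by linarith), mul_zero]
  have hAi : ∀ t, 0 ≤ t → Integrable (fun x => ρ t x * ‖u t x‖ ^ 2) := fun t ht =>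
    ((hρ1 t).continuous.mul ((huc t).norm.pow 2)).integrable_of_hasCompactSupport
      (hcs t ht).mul_right
  have hWi : ∀ t, 0 ≤ t → Integrable (fun x => ρ t x * auxPhi N (ρ t) x) := fun t ht =>
    ((hρ1 t).continuous.mul (auxPhi_C1 hN3 _ (hρ1 t) (hcs t ht)).continuous).integrable_of_hasCompactSupport
      (hcs t ht).mul_right
  have hE' : ∀ t, 0 ≤ t → (1 / 2) * (∫ x, ρ t x * ‖u t x‖ ^ 2)
      + (1 / (γ - 1)) * (∫ x, K * ρ t x ^ γ)
      + (1 / 2) * g * (∫ x, ρ t x * auxPhi N (ρ t) x) = 0 := by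
    intro t ht
    rw [← hE t ht, energy, setIntegral_eq_integral_of_forall_compl_eq_zero, aux_potential]
    · rw [← integral_const_mul, ← integral_const_mul, ← integral_const_mul, ← integral_add,
        ← integral_add]
      · congr 1; funext x; ring
      · exact ((hAi t ht).const_mul _).add ((hPi t ht).const_mul _)
      · exact (hWi t ht).const_mul _
      · exact (hAi t ht).const_mul _
      · exact (hPi t ht).const_mul _
    · intro x hx
      rw [hΩz t ht x hx, Real.zero_rpow (by linarith)]; simp
  -- lower bound on the pressure integral
  have hvol : volume Ω ≠ ⊤ := hsol.omega_bounded.measure_lt_top.ne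
  obtain ⟨c, hc, hPlow⟩ : ∃ c > 0, ∀ t, 0 ≤ t → c ≤ ∫ x, K * ρ t x ^ γ := by
    set V := (volume Ω).toReal with hV
    have hV0 : 0 ≤ V := ENNReal.toReal_nonneg
    set ε := M / (2 * (V + 1)) with hε
    have hε0 : 0 < ε := by positivity
    have hεV : ε * V ≤ M / 2 := by
      rw [hε, div_mul_eq_mul_div, div_le_div_iff₀ (by positivity) (by positivity)]
      nlinarith
    refine ⟨K * ε ^ (γ - 1) * (M / 2), by positivity, fun t ht => ?_⟩
    have hpt : ∀ x, K * ε ^ (γ - 1) * (ρ t x - ε) ≤ K * ρ t x ^ γ := by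
      intro x
      have h0 := hsol.rho_nonneg t x
      rw [mul_assoc]
      apply mul_le_mul_of_nonneg_left _ hK.le
      rcases le_total (ρ t x) ε with h | h
      · exact (mul_nonpos_of_nonneg_of_nonpos (Real.rpow_nonneg hε0.le _) (by linarith)).trans
          (Real.rpow_nonneg h0 _)
      · have hp : 0 < ρ t x := lt_of_lt_of_le hε0 h
        have e : ρ t x ^ γ = ρ t x ^ (γ - 1) * ρ t x := by
          conv_rhs => rw [← Real.rpow_one (ρ t x)]
          rw [Real.rpow_one, ← Real.rpow_add_one hp.ne']; congr 1; ring
        rw [e]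
        exact mul_le_mul (Real.rpow_le_rpow hε0.le h (by linarith)) (by linarith) (by linarith)
          (Real.rpow_nonneg h0 _)
    haveI : IsFiniteMeasure (volume.restrict Ω) := ⟨by simpa using hvol.lt_top⟩
    have hint : ∫ x in Ω, K * ε ^ (γ - 1) * (ρ t x - ε) ≤ ∫ x in Ω, K * ρ t x ^ γ :=
      integral_mono (((hρi t ht).integrableOn.sub (integrable_const ε)).const_mul _)
        (hPi t ht).integrableOn hpt
    rw [integral_const_mul, integral_sub (hρi t ht).integrableOn (integrable_const ε), hM t ht,
      setIntegral_eq_integral_of_forall_compl_eq_zero (f := fun x => K * ρ t x ^ γ)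
        (fun x hx => by rw [hΩz t ht x hx, Real.zero_rpow (by linarith), mul_zero])] at hint
    have hcst : ∫ x in Ω, ε = ε * V := by
      simp [hV, measureReal_def, mul_comm]
    rw [hcst] at hint
    refine le_trans ?_ hint
    apply mul_le_mul_of_nonneg_left _ (by positivity)
    linarith
  set κ := (N : ℝ) - ((N : ℝ) - 2) / (γ - 1) with hκ
  have hκ0 : 0 < κ := by
    rw [hκ, sub_pos, div_lt_iff₀ (by linarith)]
    linarith
  refine aux_blowup (fun t => ∫ x, ‖x‖ ^ 2 * ρ t x) (auxF N ρ u) _ (κ * c) (R ^ 2 * M)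
    (by positivity) (fun t ht => aux_H hsol R hR t ht)
    (fun t ht => aux_F hN3 hγ1.le hsol R hR t ht) ?_ ?_
  · intro t ht
    have hA0 : 0 ≤ ∫ x, ρ t x * ‖u t x‖ ^ 2 := integral_nonneg fun x =>
      mul_nonneg (hsol.rho_nonneg t x) (by positivity)
    have h1 := hE' t ht.le
    have h2 := mul_le_mul_of_nonneg_left (hPlow t ht.le) hκ0.le
    set A := ∫ x, ρ t x * ‖u t x‖ ^ 2
    set P := ∫ x, K * ρ t x ^ γ
    set W := ∫ x, ρ t x * auxPhi N (ρ t) x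
    have e : A + N * P + g * (((N : ℝ) - 2) / 2) * W = (4 - (N : ℝ)) / 2 * A + κ * P := by
      rw [hκ]
      linear_combination ((N : ℝ) - 2) * h1
    rw [e]
    nlinarith [mul_nonneg (sub_nonneg.2 hN4r) hA0]
  · intro t ht
    rw [← hM' t ht.le, ← integral_const_mul]
    refine integral_mono ?_ ((hρi t ht.le).const_mul _) ?_
    · exact ((continuous_norm.pow 2).mul (hρ1 t).continuous).integrable_of_hasCompactSupport
        (hcs t ht.le).mul_left
    · intro x
      show ‖x‖ ^ 2 * ρ t x ≤ R ^ 2 * ρ t x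
      rcases le_or_gt ‖x‖ R with h | h
      · exact mul_le_mul_of_nonneg_right (by gcongr) (hsol.rho_nonneg t x)
      · rw [hR t ht.le x h]; simp
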